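/- Let p = 1, m > 0 and A = [−m, m], i.e., the constraint is |θ1 − θ2| ≤ m. Define τ = √(σ1² + σ_Y²), β = σ1²/(σ1² + σ_Y²), σ_T² = σ2² + βσ_Y². Let q̂_mre(y; x) = (1/τ)φ((y − x1)/τ), and let q̂_B(y; x) = (1/τ)φ((y − x1)/τ) · [ Φ( (β(y − x1) + (x1 − x2) + m)/σ_T ) − Φ( (β(y − x1) + (x1 − x2) − m)/σ_T ) ] / [ Φ( (x1 − x2 + m)/√(σ1² + σ2²) ) − Φ( (x1 − x2 − m)/√(σ1² + σ2²) ) ] be the Bayes predictive density under the uniform prior 1_{[−m,m]}(θ1 − θ2). Then for every (θ1, θ2) with |θ1 − θ2| ≤ m, R_KL(θ, q̂_B) < R_KL(θ, q̂_mre); i.e., q̂_B strictly dominates q̂_mre under Kullback–Leibler risk on the restricted parameter space. -/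

import Mathlib

open MeasureTheory Real Set

noncomputable section

/-- Standard normal probability density function. -/
def stdPdf (z : ℝ) : ℝ := (Real.sqrt (2 * Real.pi))⁻¹ * Real.exp (-z ^ 2 / 2)

/-- Standard normal cumulative distribution function. -/
def stdCdf (x : ℝ) : ℝ := ∫ t in Set.Iic x, stdPdf t

/-- Density of `N(θ, σ²)` (σ the standard deviation) at `y`. -/
def gd (σ : ℝ) (u : ℝ) : ℝ := σ⁻¹ * stdPdf (u / σ)

/-- Kullback–Leibler risk in the univariate model. -/
def klRisk1 (σ1 σ2 σY : ℝ) (θ1 θ2 : ℝ) (qhat : ℝ × ℝ → ℝ → ℝ) : ℝ :=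
  ∫ x : ℝ × ℝ,
    (∫ y : ℝ, gd σY (y - θ1) * Real.log (gd σY (y - θ1) / qhat x y)) *
      (gd σ1 (x.1 - θ1) * gd σ2 (x.2 - θ2))

section GaussianIntervalMass

open ProbabilityTheory

lemma stdPdf_eq_gaussianPDFReal : stdPdf = gaussianPDFReal 0 1 := by
  ext z
  simp [stdPdf, gaussianPDFReal]

lemma stdPdf_pos (z : ℝ) : 0 < stdPdf z := by
  unfold stdPdf
  positivity

lemma integrable_stdPdf : Integrable stdPdf := by
  rw [stdPdf_eq_gaussianPDFReal]
  exact integrable_gaussianPDFReal 0 1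

lemma stdCdf_sub (a b : ℝ) : stdCdf b - stdCdf a = ∫ t in a..b, stdPdf t :=
  intervalIntegral.integral_Iic_sub_Iic integrable_stdPdf.integrableOn
    integrable_stdPdf.integrableOn

lemma stdPdf_le_stdPdf {t c : ℝ} (h : |t| ≤ c) : stdPdf c ≤ stdPdf t := by
  have h' : t ^ 2 ≤ c ^ 2 := sq_le_sq.2 (h.trans (le_abs_self c))
  unfold stdPdf
  gcongr

lemma mul_stdPdf_le_stdCdf_sub {a b c : ℝ} (hab : a ≤ b) (ha : |a| ≤ c) (hb : |b| ≤ c) :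
    (b - a) * stdPdf c ≤ stdCdf b - stdCdf a := by
  rw [stdCdf_sub, ← smul_eq_mul, ← intervalIntegral.integral_const]
  refine intervalIntegral.integral_mono_on hab (by simp)
    integrable_stdPdf.intervalIntegrable fun t ht => stdPdf_le_stdPdf (abs_le.2 ⟨?_, ?_⟩)
  · linarith [ht.1, (abs_le.1 ha).1]
  · linarith [ht.2, (abs_le.1 hb).2]

lemma strictMono_stdCdf : StrictMono stdCdf := by
  intro a b hab
  have h := mul_stdPdf_le_stdCdf_sub hab.le (le_max_left |a| |b|) (le_max_right |a| |b|)
  have h' := mul_pos (sub_pos.2 hab) (stdPdf_pos (max |a| |b|))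
  linarith

lemma stdCdf_nonneg (x : ℝ) : 0 ≤ stdCdf x :=
  integral_nonneg fun t => (stdPdf_pos t).le

lemma stdCdf_le_one (x : ℝ) : stdCdf x ≤ 1 := by
  have h : ∫ t, stdPdf t = 1 := by
    rw [stdPdf_eq_gaussianPDFReal]
    exact integral_gaussianPDFReal_eq_one 0 one_ne_zero
  rw [← h]
  exact setIntegral_le_integral integrable_stdPdf (ae_of_all _ fun t => (stdPdf_pos t).le)

/-- Logarithm of the `N(0, σ²)`-mass of the interval `[w - m, w + m]`. -/
def logMass (m σ w : ℝ) : ℝ := log (stdCdf ((w + m) / σ) - stdCdf ((w - m) / σ))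

lemma mass_pos {m σ : ℝ} (hm : 0 < m) (hσ : 0 < σ) (w : ℝ) :
    0 < stdCdf ((w + m) / σ) - stdCdf ((w - m) / σ) :=
  sub_pos.2 (strictMono_stdCdf (by gcongr; linarith))

lemma measurable_logMass (m σ : ℝ) : Measurable (logMass m σ) := by
  have h := strictMono_stdCdf.monotone.measurable
  unfold logMass
  fun_prop

lemma abs_logMass_le {m σ : ℝ} (hm : 0 < m) (hσ : 0 < σ) (w : ℝ) :
    |logMass m σ w| ≤ |log (2 * m / σ)| + |log (√(2 * π))⁻¹| + (w ^ 2 + m ^ 2) / σ ^ 2 := by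
  set c := (|w| + m) / σ with hc
  have hle : logMass m σ w ≤ 0 := by
    refine log_nonpos (mass_pos hm hσ w).le ?_
    linarith [stdCdf_le_one ((w + m) / σ), stdCdf_nonneg ((w - m) / σ)]
  have hmass : 2 * m / σ * stdPdf c ≤ stdCdf ((w + m) / σ) - stdCdf ((w - m) / σ) := by
    have h := mul_stdPdf_le_stdCdf_sub (a := (w - m) / σ) (b := (w + m) / σ) (c := c)
      (by gcongr; linarith) ?_ ?_
    · convert h using 2
      ring
    · rw [abs_div, abs_of_pos hσ, hc]
      gcongr
      simpa [abs_of_pos hm] using abs_sub w m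
    · rw [abs_div, abs_of_pos hσ, hc]
      gcongr
      simpa [abs_of_pos hm] using abs_add_le w m
  have hlog : log (2 * m / σ) + log (√(2 * π))⁻¹ - c ^ 2 / 2 ≤ logMass m σ w := by
    refine le_trans (le_of_eq ?_) (log_le_log (mul_pos (by positivity) (stdPdf_pos c)) hmass)
    rw [log_mul (by positivity) (stdPdf_pos c).ne', stdPdf, log_mul (by positivity) (by positivity),
      log_exp]
    ring
  have hsq : c ^ 2 / 2 ≤ (w ^ 2 + m ^ 2) / σ ^ 2 := by
    rw [hc, div_pow, div_div, mul_comm, ← div_div]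
    gcongr
    nlinarith [sq_nonneg (|w| - m), sq_abs w]
  rw [abs_of_nonpos hle]
  linarith [neg_abs_le (log (2 * m / σ)), neg_abs_le (log (√(2 * π))⁻¹)]

lemma integrable_logMass {m σ : ℝ} (hm : 0 < m) (hσ : 0 < σ) (μ : ℝ) (v : NNReal) :
    Integrable (logMass m σ) (gaussianReal μ v) := by
  have hsq : Integrable (fun w : ℝ => w ^ 2) (gaussianReal μ v) :=
    (memLp_id_gaussianReal 2).integrable_sq
  refine Integrable.mono' (g := fun w => |log (2 * m / σ)| + |log (√(2 * π))⁻¹| +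
    (w ^ 2 + m ^ 2) / σ ^ 2) (by fun_prop) (measurable_logMass m σ).aestronglyMeasurable
    (ae_of_all _ fun w => abs_logMass_le hm hσ w)

/-- A Gaussian law of standard deviation `σ`, mean `μ`, as the image of the standard one. -/
lemma gaussianReal_eq_map_std (μ σ : ℝ) :
    gaussianReal μ (σ ^ 2).toNNReal = (gaussianReal 0 1).map fun z => μ + σ * z := by
  have h : (fun z : ℝ => μ + σ * z) = (fun x => μ + x) ∘ fun z => σ * z := rfl
  rw [h, ← Measure.map_map (by fun_prop) (by fun_prop), gaussianReal_map_const_mul,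
    gaussianReal_map_const_add]
  congr 1
  · simp
  · ext
    simp [sq_nonneg]

/-- For `|μ| ≤ m`, the expected log-mass of `[W - m, W + m]`, both `W` and the mass being
taken at scale `σ`, strictly decreases with `σ`. -/
lemma integral_logMass_lt {m μ s t : ℝ} (hμ : |μ| ≤ m) (hm : 0 < m) (hs : 0 < s) (hst : s < t) :
    ∫ w, logMass m t w ∂gaussianReal μ (t ^ 2).toNNReal <
      ∫ w, logMass m s w ∂gaussianReal μ (s ^ 2).toNNReal := by
  have ht := hs.trans hst
  obtain ⟨hμ₁, hμ₂⟩ := abs_le.1 hμ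
  have hint : ∀ {σ : ℝ}, 0 < σ →
      Integrable (fun z => logMass m σ (μ + σ * z)) (gaussianReal 0 1) := fun {σ} hσ => by
    have h := integrable_logMass hm hσ μ (σ ^ 2).toNNReal
    rw [gaussianReal_eq_map_std] at h
    exact h.comp_measurable (by fun_prop)
  have hpt : ∀ z, logMass m t (μ + t * z) < logMass m s (μ + s * z) := fun z => by
    refine log_lt_log (mass_pos hm ht _) ?_
    have e : ∀ σ : ℝ, 0 < σ → ∀ d, (μ + σ * z + d) / σ = z + (μ + d) / σ := fun σ hσ d => by
      field_simp
      ring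
    simp only [sub_eq_add_neg _ m, e t ht, e s hs]
    have hup : (μ + m) / t ≤ (μ + m) / s :=
      div_le_div_of_nonneg_left (by linarith) hs hst.le
    have hlo : (μ + -m) / s ≤ (μ + -m) / t := by
      have h := div_le_div_of_nonneg_left (show 0 ≤ m - μ by linarith) hs hst.le
      rw [show μ + -m = -(m - μ) by ring, neg_div, neg_div]
      linarith
    rcases hμ₁.lt_or_eq with h | h
    · have hup' : (μ + m) / t < (μ + m) / s :=
        div_lt_div_of_pos_left (by linarith) hs hst
      have h1 := strictMono_stdCdf (add_lt_add_right hup' z)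
      have h2 := strictMono_stdCdf.monotone (add_le_add_right hlo z)
      linarith
    · have hlo' : (μ + -m) / s < (μ + -m) / t := by
        have h := div_lt_div_of_pos_left (show 0 < m - μ by linarith) hs hst
        rw [show μ + -m = -(m - μ) by ring, neg_div, neg_div]
        linarith
      have h1 := strictMono_stdCdf.monotone (add_le_add_right hup z)
      have h2 := strictMono_stdCdf (add_lt_add_right hlo' z)
      linarith
  rw [gaussianReal_eq_map_std, gaussianReal_eq_map_std,
    integral_map (by fun_prop) (measurable_logMass _ _).aestronglyMeasurable,
    integral_map (by fun_prop) (measurable_logMass _ _).aestronglyMeasurable,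
    ← sub_pos, ← integral_sub (hint hs) (hint ht),
    integral_pos_iff_support_of_nonneg (fun z => (sub_pos.2 (hpt z)).le)
      ((hint hs).sub (hint ht))]
  have hsupp : (Function.support fun z => logMass m s (μ + s * z) - logMass m t (μ + t * z)) =
      univ := eq_univ_of_forall fun z => (sub_pos.2 (hpt z)).ne'
  simp [hsupp]

end GaussianIntervalMass

section Model

open ProbabilityTheory

lemma gd_pos {σ : ℝ} (hσ : 0 < σ) (u : ℝ) : 0 < gd σ u :=
  mul_pos (inv_pos.2 hσ) (stdPdf_pos _)

lemma log_gd {σ : ℝ} (hσ : 0 < σ) (u : ℝ) :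
    log (gd σ u) = log (σ⁻¹ * (√(2 * π))⁻¹) - u ^ 2 / (2 * σ ^ 2) := by
  rw [gd, stdPdf, ← mul_assoc, log_mul (by positivity) (by positivity), log_exp]
  field_simp
  ring

lemma gd_sub_eq_gaussianPDFReal {σ : ℝ} (hσ : 0 < σ) (θ x : ℝ) :
    gd σ (x - θ) = gaussianPDFReal θ (σ ^ 2).toNNReal x := by
  have h : √(2 * π * σ ^ 2) = √(2 * π) * σ := by
    rw [sqrt_mul (by positivity), sqrt_sq hσ.le]
  rw [gd, stdPdf, gaussianPDFReal, coe_toNNReal _ (sq_nonneg σ), h, mul_inv, ← mul_assoc,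
    mul_comm σ⁻¹]
  congr 2
  field_simp

lemma toNNReal_sq_ne_zero {σ : ℝ} (hσ : 0 < σ) : (σ ^ 2).toNNReal ≠ 0 :=
  (toNNReal_pos.2 (by positivity)).ne'

/-- Joint law of `((X₁, X₂), Y₁)`. -/
abbrev modelLaw (σ1 σ2 σY θ1 θ2 : ℝ) : Measure ((ℝ × ℝ) × ℝ) :=
  ((gaussianReal θ1 (σ1 ^ 2).toNNReal).prod (gaussianReal θ2 (σ2 ^ 2).toNNReal)).prod
    (gaussianReal θ1 (σY ^ 2).toNNReal)

lemma klRisk1_eq_integral {σ1 σ2 σY : ℝ} (h1 : 0 < σ1) (h2 : 0 < σ2) (hY : 0 < σY) (θ1 θ2 : ℝ)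
    {qhat : ℝ × ℝ → ℝ → ℝ}
    (hq : Integrable (fun p : (ℝ × ℝ) × ℝ => log (gd σY (p.2 - θ1) / qhat p.1 p.2))
      (modelLaw σ1 σ2 σY θ1 θ2)) :
    klRisk1 σ1 σ2 σY θ1 θ2 qhat =
      ∫ p, log (gd σY (p.2 - θ1) / qhat p.1 p.2) ∂modelLaw σ1 σ2 σY θ1 θ2 := by
  rw [integral_prod _ hq, gaussianReal_of_var_ne_zero θ1 (toNNReal_sq_ne_zero h1),
    gaussianReal_of_var_ne_zero θ2 (toNNReal_sq_ne_zero h2),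
    prod_withDensity (measurable_gaussianPDF _ _) (measurable_gaussianPDF _ _),
    integral_withDensity_eq_integral_toReal_smul (by fun_prop)
      (ae_of_all _ fun z => ENNReal.mul_lt_top gaussianPDF_lt_top gaussianPDF_lt_top)]
  unfold klRisk1
  refine integral_congr_ae (ae_of_all _ fun x => ?_)
  simp only [ENNReal.toReal_mul, toReal_gaussianPDF, smul_eq_mul,
    integral_gaussianReal_eq_integral_smul (toNNReal_sq_ne_zero hY),
    gd_sub_eq_gaussianPDFReal h1, gd_sub_eq_gaussianPDFReal h2, gd_sub_eq_gaussianPDFReal hY]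
  exact mul_comm _ _

lemma hasLaw_linear_combination (σ1 σ2 σY θ1 θ2 a b c : ℝ) :
    HasLaw (fun p : (ℝ × ℝ) × ℝ => a * p.1.1 + b * p.1.2 + c * p.2)
      (gaussianReal (a * θ1 + b * θ2 + c * θ1)
        (a ^ 2 * σ1 ^ 2 + b ^ 2 * σ2 ^ 2 + c ^ 2 * σY ^ 2).toNNReal)
      (modelLaw σ1 σ2 σY θ1 θ2) := by
  have h12 := (indepFun_prod (μ := gaussianReal θ1 (σ1 ^ 2).toNNReal)
      (ν := gaussianReal θ2 (σ2 ^ 2).toNNReal) (measurable_const_mul a)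
      (measurable_const_mul b)).hasLaw_fun_add
    (gaussianReal_const_mul measurePreserving_fst.hasLaw a)
    (gaussianReal_const_mul measurePreserving_snd.hasLaw b)
  have hfst : HasLaw (Prod.fst : (ℝ × ℝ) × ℝ → ℝ × ℝ) _ (modelLaw σ1 σ2 σY θ1 θ2) :=
    measurePreserving_fst.hasLaw
  have h := (indepFun_prod (X := fun x : ℝ × ℝ => a * x.1 + b * x.2) (by fun_prop)
      (measurable_const_mul c)).hasLaw_fun_add (h12.fun_comp hfst)
    (gaussianReal_const_mul measurePreserving_snd.hasLaw c)
  rw [gaussianReal_conv_gaussianReal, gaussianReal_conv_gaussianReal] at h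
  convert h using 2
  ext
  rw [coe_toNNReal _ (by positivity)]
  simp [sq_nonneg]

lemma integrable_log_gd_div {σ1 σ2 σY τ : ℝ} (hY : 0 < σY) (hτ : 0 < τ) (θ1 θ2 : ℝ) :
    Integrable (fun p : (ℝ × ℝ) × ℝ => log (gd σY (p.2 - θ1) / gd τ (p.2 - p.1.1)))
      (modelLaw σ1 σ2 σY θ1 θ2) := by
  have hX : MemLp (fun p : (ℝ × ℝ) × ℝ => p.1.1) 2 (modelLaw σ1 σ2 σY θ1 θ2) :=
    (memLp_id_gaussianReal 2).comp_measurePreserving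
      (measurePreserving_fst.comp measurePreserving_fst)
  have hY' : MemLp (fun p : (ℝ × ℝ) × ℝ => p.2) 2 (modelLaw σ1 σ2 σY θ1 θ2) :=
    (memLp_id_gaussianReal 2).comp_measurePreserving measurePreserving_snd
  have hsq1 : Integrable (fun p : (ℝ × ℝ) × ℝ => (p.2 - θ1) ^ 2) (modelLaw σ1 σ2 σY θ1 θ2) :=
    (hY'.sub (memLp_const θ1)).integrable_sq
  have hsq2 : Integrable (fun p : (ℝ × ℝ) × ℝ => (p.2 - p.1.1) ^ 2)
      (modelLaw σ1 σ2 σY θ1 θ2) :=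
    (hY'.sub hX).integrable_sq
  simp only [log_div (gd_pos hY _).ne' (gd_pos hτ _).ne', log_gd hY, log_gd hτ]
  fun_prop

end Model

open ProbabilityTheory in
/-- For `p = 1`, `A = [-m, m]`, the uniform-prior Bayes predictive density strictly
dominates the minimum risk equivariant predictive density under Kullback–Leibler risk
on `{|θ1 - θ2| ≤ m}`. -/
theorem stmt17 (σ1 σ2 σY : ℝ) (h1 : 0 < σ1) (h2 : 0 < σ2) (hY : 0 < σY)
    (m : ℝ) (hm : 0 < m)
    (τ β σT : ℝ) (hτ : τ = Real.sqrt (σ1 ^ 2 + σY ^ 2))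
    (hβ : β = σ1 ^ 2 / (σ1 ^ 2 + σY ^ 2))
    (hσT : σT = Real.sqrt (σ2 ^ 2 + β * σY ^ 2)) :
    ∀ θ1 θ2 : ℝ, |θ1 - θ2| ≤ m →
      klRisk1 σ1 σ2 σY θ1 θ2
          (fun x y => τ⁻¹ * stdPdf ((y - x.1) / τ) *
            (stdCdf ((β * (y - x.1) + (x.1 - x.2) + m) / σT) -
              stdCdf ((β * (y - x.1) + (x.1 - x.2) - m) / σT)) /
            (stdCdf ((x.1 - x.2 + m) / Real.sqrt (σ1 ^ 2 + σ2 ^ 2)) -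
              stdCdf ((x.1 - x.2 - m) / Real.sqrt (σ1 ^ 2 + σ2 ^ 2)))) <
        klRisk1 σ1 σ2 σY θ1 θ2 (fun x y => τ⁻¹ * stdPdf ((y - x.1) / τ)) := by
  intro θ1 θ2 hθ
  have hτ0 : 0 < τ := by rw [hτ]; positivity
  have hβ0 : 0 < β := by rw [hβ]; positivity
  have hσT0 : 0 < σT := by rw [hσT]; positivity
  set s := √(σ1 ^ 2 + σ2 ^ 2) with hs
  have hs0 : 0 < s := by rw [hs]; positivity
  have hs2 : s ^ 2 = σ1 ^ 2 + σ2 ^ 2 := sq_sqrt (by positivity)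
  have hσT2 : σT ^ 2 = σ2 ^ 2 + β * σY ^ 2 := by rw [hσT, sq_sqrt (by positivity)]
  have hlt : σT < s := by
    rw [hσT, hs]
    refine sqrt_lt_sqrt (by positivity) ?_
    have h : β * σY ^ 2 < σ1 ^ 2 := by
      rw [hβ, div_mul_eq_mul_div, div_lt_iff₀ (by positivity)]
      nlinarith [pow_pos h1 4]
    linarith
  have hW : HasLaw (fun p : (ℝ × ℝ) × ℝ => β * (p.2 - p.1.1) + (p.1.1 - p.1.2))
      (gaussianReal (θ1 - θ2) (σT ^ 2).toNNReal) (modelLaw σ1 σ2 σY θ1 θ2) := by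
    have h := hasLaw_linear_combination σ1 σ2 σY θ1 θ2 (1 - β) (-1) β
    convert h using 2
    · ring
    · ring
    · congr 1
      rw [hσT2, hβ]
      field_simp
      ring
  have hV : HasLaw (fun p : (ℝ × ℝ) × ℝ => p.1.1 - p.1.2)
      (gaussianReal (θ1 - θ2) (s ^ 2).toNNReal) (modelLaw σ1 σ2 σY θ1 θ2) := by
    have h := hasLaw_linear_combination σ1 σ2 σY θ1 θ2 1 (-1) 0
    convert h using 2
    · ring
    · ring
    · congr 1
      rw [hs2]
      ring
  have hintW := (hW.measurePreserving (by fun_prop)).integrable_comp_of_integrable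
    (integrable_logMass hm hσT0 (θ1 - θ2) (σT ^ 2).toNNReal)
  have hintV := (hV.measurePreserving (by fun_prop)).integrable_comp_of_integrable
    (integrable_logMass hm hs0 (θ1 - θ2) (s ^ 2).toNNReal)
  have hL := integrable_log_gd_div (σ1 := σ1) (σ2 := σ2) hY hτ0 θ1 θ2
  have hsplit : (fun p : (ℝ × ℝ) × ℝ => log (gd σY (p.2 - θ1) /
      (τ⁻¹ * stdPdf ((p.2 - p.1.1) / τ) *
        (stdCdf ((β * (p.2 - p.1.1) + (p.1.1 - p.1.2) + m) / σT) -
          stdCdf ((β * (p.2 - p.1.1) + (p.1.1 - p.1.2) - m) / σT)) /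
        (stdCdf ((p.1.1 - p.1.2 + m) / s) - stdCdf ((p.1.1 - p.1.2 - m) / s))))) =
      fun p => log (gd σY (p.2 - θ1) / gd τ (p.2 - p.1.1)) -
        (logMass m σT ∘ fun p : (ℝ × ℝ) × ℝ => β * (p.2 - p.1.1) + (p.1.1 - p.1.2)) p +
        (logMass m s ∘ fun p : (ℝ × ℝ) × ℝ => p.1.1 - p.1.2) p := by
    ext p
    have hN := mass_pos hm hσT0 (β * (p.2 - p.1.1) + (p.1.1 - p.1.2))
    have hD := mass_pos hm hs0 (p.1.1 - p.1.2)
    have hg := gd_pos hτ0 (p.2 - p.1.1)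
    have hgY := gd_pos hY (p.2 - θ1)
    simp only [Function.comp_apply, logMass]
    rw [← gd, log_div hgY.ne' (div_pos (mul_pos hg hN) hD).ne',
      log_div (mul_pos hg hN).ne' hD.ne', log_mul hg.ne' hN.ne', log_div hgY.ne' hg.ne']
    ring
  have hLW := hL.sub hintW
  simp only [Pi.sub_def] at hLW
  rw [klRisk1_eq_integral h1 h2 hY θ1 θ2 (by rw [hsplit]; exact hLW.add hintV),
    klRisk1_eq_integral h1 h2 hY θ1 θ2 hL, hsplit, integral_add hLW hintV,
    integral_sub hL hintW,
    hW.integral_comp (measurable_logMass m σT).aestronglyMeasurable,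
    hV.integral_comp (measurable_logMass m s).aestronglyMeasurable]
  have h := integral_logMass_lt hθ hm hσT0 hlt
  change _ < ∫ p : (ℝ × ℝ) × ℝ, log (gd σY (p.2 - θ1) / gd τ (p.2 - p.1.1)) ∂_
  linarith

end
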